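/- arXiv:1610.01553 — 3 statements merged into one kernel-verified Lean document; each statement's English description precedes it below -/
import Mathlib

section
/- Let S ∈ ℝ^{n×n}, d ∈ ℝ^n, and let P ∈ ℝ^{n×n} be symmetric positive definite with SᵀP + PS − 2P d dᵀ P negative definite. Then for every real λ ≥ 1, the matrix (S − λ d dᵀ P)ᵀP + P(S − λ d dᵀ P) is negative definite, and consequently S − λ d dᵀ P is Hurwitz. -/
open Matrix

/-- A real square matrix is Hurwitz if every eigenvalue of it, viewed as a complex
matrix, has strictly negative real part. -/
def Hurwitz {ι : Type*} [Fintype ι] [DecidableEq ι] (A : Matrix ι ι ℝ) : Prop :=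
  ∀ μ ∈ spectrum ℂ (A.map (algebraMap ℝ ℂ)), μ.re < 0

/-- The quadratic form of a continuous-time Lyapunov expression. -/
theorem dotProduct_lyapunov_mulVec {ι : Type*} [Fintype ι] {A P : Matrix ι ι ℝ}
    (hP : Pᵀ = P) (x : ι → ℝ) :
    x ⬝ᵥ ((Aᵀ * P + P * A) *ᵥ x) = 2 * (A *ᵥ x ⬝ᵥ P *ᵥ x) := by
  have h₁ : x ⬝ᵥ ((Aᵀ * P) *ᵥ x) = A *ᵥ x ⬝ᵥ P *ᵥ x := by
    rw [← mulVec_mulVec, dotProduct_mulVec, vecMul_transpose]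
  have h₂ : x ⬝ᵥ ((P * A) *ᵥ x) = A *ᵥ x ⬝ᵥ P *ᵥ x := by
    rw [← mulVec_mulVec, dotProduct_mulVec, ← mulVec_transpose, hP, dotProduct_comm]
  rw [add_mulVec, dotProduct_add, h₁, h₂, two_mul]

/-- Lyapunov's criterion: `A` is Hurwitz if `Aᵀ P + P A` is negative definite for some positive
definite `P`. -/
theorem hurwitz_of_posDef_neg_lyapunov {ι : Type*} [Fintype ι] [DecidableEq ι]
    {A P : Matrix ι ι ℝ} (hP : P.PosDef) (hA : (-(Aᵀ * P + P * A)).PosDef) : Hurwitz A := by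
  have hPt : Pᵀ = P := by simpa using hP.isHermitian.eq
  intro μ hμ
  rw [← spectrum_toLin', ← Module.End.hasEigenvalue_iff_mem_spectrum] at hμ
  obtain ⟨v, hv⟩ := hμ.exists_hasEigenvector
  have hAv : A.map (algebraMap ℝ ℂ) *ᵥ v = μ • v := by simpa using hv.apply_eq_smul
  set x : ι → ℝ := fun i => (v i).re with hx
  set y : ι → ℝ := fun i => (v i).im with hy
  have hAx : A *ᵥ x = μ.re • x - μ.im • y := by
    ext i
    simpa [mulVec, dotProduct, hx, hy] using congrArg Complex.re (congrFun hAv i)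
  have hAy : A *ᵥ y = μ.re • y + μ.im • x := by
    ext i
    simpa [mulVec, dotProduct, hx, hy] using congrArg Complex.im (congrFun hAv i)
  have hxy : x ≠ 0 ∨ y ≠ 0 := by
    by_contra! h
    exact hv.2 (funext fun i => Complex.ext (congrFun h.1 i) (congrFun h.2 i))
  have hsymm : y ⬝ᵥ P *ᵥ x = x ⬝ᵥ P *ᵥ y := by
    rw [dotProduct_mulVec, ← mulVec_transpose, hPt, dotProduct_comm]
  have hform : ∀ z, 0 ≤ -(2 * (A *ᵥ z ⬝ᵥ P *ᵥ z)) := fun z => by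
    simpa only [neg_mulVec, dotProduct_neg, star_trivial, dotProduct_lyapunov_mulVec hPt]
      using hA.posSemidef.dotProduct_mulVec_nonneg z
  have hform_pos : ∀ z, z ≠ 0 → 0 < -(2 * (A *ᵥ z ⬝ᵥ P *ᵥ z)) := fun z hz => by
    simpa only [neg_mulVec, dotProduct_neg, star_trivial, dotProduct_lyapunov_mulVec hPt]
      using hA.dotProduct_mulVec_pos hz
  have hsum : A *ᵥ x ⬝ᵥ P *ᵥ x + A *ᵥ y ⬝ᵥ P *ᵥ y
      = μ.re * (x ⬝ᵥ P *ᵥ x + y ⬝ᵥ P *ᵥ y) := by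
    simp only [hAx, hAy, sub_dotProduct, add_dotProduct, smul_dotProduct, smul_eq_mul, hsymm]
    ring
  have hneg : μ.re * (x ⬝ᵥ P *ᵥ x + y ⬝ᵥ P *ᵥ y) < 0 := by
    rw [← hsum]
    rcases hxy with h | h
    · linarith [hform_pos x h, hform y]
    · linarith [hform x, hform_pos y h]
  have hPx : 0 ≤ x ⬝ᵥ P *ᵥ x := by simpa using hP.posSemidef.dotProduct_mulVec_nonneg x
  have hPy : 0 ≤ y ⬝ᵥ P *ᵥ y := by simpa using hP.posSemidef.dotProduct_mulVec_nonneg y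
  exact neg_of_mul_neg_left hneg (add_nonneg hPx hPy)

/-- Per-eigenvalue block computation in the proof of Theorem 2. -/
theorem stmt_6 (n : ℕ) (S P : Matrix (Fin n) (Fin n) ℝ) (d : Fin n → ℝ)
    (hP : P.PosDef)
    (hLyap : (-(Sᵀ * P + P * S - (2 : ℝ) • (P * Matrix.vecMulVec d d * P))).PosDef) :
    ∀ lam : ℝ, 1 ≤ lam →
      (-((S - lam • (Matrix.vecMulVec d d * P))ᵀ * P
          + P * (S - lam • (Matrix.vecMulVec d d * P)))).PosDef
      ∧ Hurwitz (S - lam • (Matrix.vecMulVec d d * P)) := by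
  intro lam hlam
  have hPt : Pᵀ = P := by simpa using hP.isHermitian.eq
  have hsemi : (P * vecMulVec d d * P).PosSemidef := by
    simpa [hPt] using (posSemidef_vecMulVec_self_star d).conjTranspose_mul_mul_same P
  have hdecomp : -((S - lam • (vecMulVec d d * P))ᵀ * P + P * (S - lam • (vecMulVec d d * P)))
      = -(Sᵀ * P + P * S - (2 : ℝ) • (P * vecMulVec d d * P))
        + (2 * lam - 2) • (P * vecMulVec d d * P) := by
    simp only [transpose_sub, transpose_smul, transpose_mul, transpose_vecMulVec, hPt, sub_mul,
      mul_sub, smul_mul_assoc, mul_smul_comm, Matrix.mul_assoc]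
    module
  have hneg := hdecomp ▸ hLyap.add_posSemidef (hsemi.smul (by linarith : 0 ≤ 2 * lam - 2))
  exact ⟨hneg, hurwitz_of_posDef_neg_lyapunov hP hneg⟩
end

section
/- Let n, N be positive integers, S ∈ ℝ^{n×n}, d ∈ ℝ^n, P ∈ ℝ^{n×n} symmetric positive definite with SᵀP + PS − 2P d dᵀ P negative definite, and H ∈ ℝ^{N×N} symmetric positive definite with smallest eigenvalue λ_N > 0. Then for every γ ≥ 1/λ_N, the matrix (I_N ⊗ S − γ·H ⊗ (d dᵀ P))ᵀ(I_N ⊗ P) + (I_N ⊗ P)(I_N ⊗ S − γ·H ⊗ (d dᵀ P)) is negative definite. -/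
open Matrix Kronecker

/-- A Hermitian matrix whose eigenvalues are all at least `c` dominates `c • 1` in the
Loewner order. -/
theorem Matrix.IsHermitian.posSemidef_sub_smul_one {m : Type*} [Fintype m] [DecidableEq m]
    {A : Matrix m m ℝ} (hA : A.IsHermitian) {c : ℝ} (hc : ∀ i, c ≤ hA.eigenvalues i) :
    (A - c • (1 : Matrix m m ℝ)).PosSemidef := by
  have hD : (diagonal fun i => hA.eigenvalues i - c).PosSemidef :=
    PosSemidef.diagonal fun i => sub_nonneg.mpr (hc i)
  have hU := Unitary.mul_star_self_of_mem hA.eigenvectorUnitary.2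
  have hA' := hA.spectral_theorem
  rw [Unitary.conjStarAlgAut_apply] at hA'
  have hsub : A - c • (1 : Matrix m m ℝ) = (hA.eigenvectorUnitary : Matrix m m ℝ) *
      (diagonal fun i => hA.eigenvalues i - c) *
        (hA.eigenvectorUnitary : Matrix m m ℝ)ᴴ := by
    have hdiag : (diagonal fun i => hA.eigenvalues i - c) =
        diagonal (RCLike.ofReal ∘ hA.eigenvalues) - c • (1 : Matrix m m ℝ) := by
      rw [smul_one_eq_diagonal, diagonal_sub]
      rfl
    rw [hdiag, ← star_eq_conjTranspose, mul_sub, sub_mul, ← hA', mul_smul_comm, mul_one,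
      smul_mul_assoc, hU]
  rw [hsub]
  exact hD.mul_mul_conjTranspose_same _

/-- Explicit Lyapunov certificate `I_N ⊗ P` for the closed-loop network matrix of
Theorem 2. -/
theorem stmt_8 (n N : ℕ) (hn : 0 < n) (hN : 0 < N)
    (S P : Matrix (Fin n) (Fin n) ℝ) (d : Fin n → ℝ)
    (hP : P.PosDef)
    (hLyap : (-(Sᵀ * P + P * S - (2 : ℝ) • (P * Matrix.vecMulVec d d * P))).PosDef)
    (H : Matrix (Fin N) (Fin N) ℝ) (hH : H.PosDef)
    (lamN : ℝ) (hlamN : IsLeast (Set.range hH.1.eigenvalues) lamN) (hlamNpos : 0 < lamN) :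
    ∀ γ : ℝ, 1 / lamN ≤ γ →
      (-(((1 : Matrix (Fin N) (Fin N) ℝ) ⊗ₖ S
            - γ • (H ⊗ₖ (Matrix.vecMulVec d d * P)))ᵀ
            * ((1 : Matrix (Fin N) (Fin N) ℝ) ⊗ₖ P)
          + ((1 : Matrix (Fin N) (Fin N) ℝ) ⊗ₖ P)
            * ((1 : Matrix (Fin N) (Fin N) ℝ) ⊗ₖ S
            - γ • (H ⊗ₖ (Matrix.vecMulVec d d * P))))).PosDef := by
  intro γ hγ
  have hPt : Pᵀ = P := by simpa using hP.1.eq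
  have hHt : Hᵀ = H := by simpa using hH.1.eq
  have hγ0 : 0 < γ := (one_div_pos.mpr hlamNpos).trans_le hγ
  have hγlam : 1 ≤ γ * lamN := (div_le_iff₀ hlamNpos).mp hγ
  have hH1 : (γ • H - (1 : Matrix (Fin N) (Fin N) ℝ)).PosSemidef := by
    have h1 := (hH.1.posSemidef_sub_smul_one fun i => hlamN.2 ⟨i, rfl⟩).smul hγ0.le
    have h2 := (PosSemidef.one (n := Fin N) (R := ℝ)).smul (sub_nonneg.mpr hγlam)
    convert h1.add h2 using 1
    module
  have hR : (P * vecMulVec d d * P).PosSemidef := by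
    have h := (posSemidef_vecMulVec_self_star d).mul_mul_conjTranspose_same P
    simpa [hPt] using h
  have hsum := ((PosDef.one (n := Fin N) (R := ℝ)).kronecker hLyap).add_posSemidef
    ((hH1.kronecker hR).smul (zero_le_two (α := ℝ)))
  refine (congrArg PosDef ?_).mpr hsum
  have hvt : (vecMulVec d d)ᵀ = vecMulVec d d := transpose_vecMulVec d d
  simp only [transpose_sub, transpose_smul, ← kroneckerMap_transpose, transpose_mul, hPt, hHt,
    hvt, transpose_one, sub_mul, mul_sub, smul_mul_assoc, mul_smul_comm, ← mul_kronecker_mul,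
    one_mul, mul_one, ← Matrix.mul_assoc]
  ext ⟨i, k⟩ ⟨j, l⟩
  simp only [Matrix.neg_apply, Matrix.add_apply, Matrix.sub_apply, Matrix.smul_apply,
    kronecker_apply, smul_eq_mul]
  ring
end

section
/- Let n, N be positive integers, S ∈ ℝ^{n×n}, d ∈ ℝ^n, P ∈ ℝ^{n×n} symmetric positive definite with SᵀP + PS − 2P d dᵀ P negative definite, and H ∈ ℝ^{N×N} symmetric positive definite with smallest eigenvalue λ_N > 0. Then for every Θ ≥ 1/λ_N, the matrix H ⊗ (SᵀP + PS) − 2Θ·H² ⊗ (P d dᵀ P) is negative definite; in particular there exists ε > 0 such that x̄ᵀ[H ⊗ (SᵀP + PS) − 2Θ·H² ⊗ (P d dᵀ P)]x̄ ≤ −ε‖x̄‖² for all x̄ ∈ ℝ^{Nn}. -/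
open Matrix Kronecker

/-- If `c` bounds the eigenvalues of `A` from below and `1 ≤ t * c`, then `A ≤ t • A ^ 2`. -/
theorem Matrix.PosDef.posSemidef_smul_mul_self_sub {m : Type*} [Fintype m] [DecidableEq m]
    {A : Matrix m m ℝ} (hA : A.PosDef) {c t : ℝ} (hc : ∀ i, c ≤ hA.1.eigenvalues i)
    (hc0 : 0 ≤ c) (ht0 : 0 ≤ t) (ht : 1 ≤ t * c) :
    (t • (A * A) - A).PosSemidef := by
  have hQ := hA.1.posSemidef_sub_smul_one hc
  set Q := A - c • (1 : Matrix m m ℝ) with hQdef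
  have hQQ : (Q * Q).PosSemidef := by
    simpa only [hQ.1.eq] using Matrix.posSemidef_conjTranspose_mul_self Q
  have key : t • (A * A) - A = t • (Q * Q + c • Q) + (t * c - 1) • A := by
    simp only [hQdef, sub_mul, mul_sub, smul_mul_assoc, mul_smul_comm, one_mul, mul_one]
    module
  rw [key]
  exact ((hQQ.add (hQ.smul hc0)).smul ht0).add (hA.posSemidef.smul (sub_nonneg.2 ht))

/-- The quadratic form of a positive definite matrix is coercive. -/
theorem Matrix.PosDef.exists_pos_mul_norm_sq_le {m : Type*} [Fintype m] [DecidableEq m]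
    {A : Matrix m m ℝ} (hA : A.PosDef) :
    ∃ ε > (0 : ℝ), ∀ x : EuclideanSpace ℝ m, ε * ‖x‖ ^ 2 ≤ x ⬝ᵥ (A *ᵥ x) := by
  obtain ⟨ε, hε, hle⟩ : ∃ ε > (0 : ℝ), ∀ i, ε ≤ hA.1.eigenvalues i := by
    cases isEmpty_or_nonempty m
    · exact ⟨1, one_pos, isEmptyElim⟩
    · obtain ⟨i, hi⟩ := Finite.exists_min hA.1.eigenvalues
      exact ⟨_, hA.eigenvalues_pos i, hi⟩
  refine ⟨ε, hε, fun x => ?_⟩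
  have h := (hA.1.posSemidef_sub_smul_one hle).dotProduct_mulVec_nonneg x
  have hx : ‖x‖ ^ 2 = x ⬝ᵥ x := by
    simp only [EuclideanSpace.real_norm_sq_eq, dotProduct, ← sq]
  rw [star_trivial, Matrix.sub_mulVec, Matrix.smul_mulVec, Matrix.one_mulVec, dotProduct_sub,
    dotProduct_smul, smul_eq_mul] at h
  rw [hx]
  linarith

/-- Bound on the term Γ₁ in the proof of Theorem 3. -/
theorem stmt_11 (n N : ℕ) (hn : 0 < n) (hN : 0 < N)
    (S P : Matrix (Fin n) (Fin n) ℝ) (d : Fin n → ℝ)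
    (hP : P.PosDef)
    (hLyap : (-(Sᵀ * P + P * S - (2 : ℝ) • (P * Matrix.vecMulVec d d * P))).PosDef)
    (H : Matrix (Fin N) (Fin N) ℝ) (hH : H.PosDef)
    (lamN : ℝ) (hlamN : IsLeast (Set.range hH.1.eigenvalues) lamN) (hlamNpos : 0 < lamN) :
    ∀ Θ : ℝ, 1 / lamN ≤ Θ →
      (-(H ⊗ₖ (Sᵀ * P + P * S)
          - (2 * Θ) • ((H * H) ⊗ₖ (P * Matrix.vecMulVec d d * P)))).PosDef
      ∧ ∃ ε > (0 : ℝ), ∀ xb : EuclideanSpace ℝ (Fin N × Fin n),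
          xb ⬝ᵥ ((H ⊗ₖ (Sᵀ * P + P * S)
            - (2 * Θ) • ((H * H) ⊗ₖ (P * Matrix.vecMulVec d d * P))).mulVec xb)
            ≤ -ε * ‖xb‖ ^ 2 := by
  intro Θ hΘ
  have hΘ0 : 0 ≤ Θ := (one_div_pos.2 hlamNpos).le.trans hΘ
  have hB : (P * Matrix.vecMulVec d d * P).PosSemidef := by
    have h := (Matrix.posSemidef_vecMulVec_self_star d).mul_mul_conjTranspose_same P
    rwa [hP.1.eq, star_trivial] at h
  have hHH := hH.posSemidef_smul_mul_self_sub (fun i => hlamN.2 ⟨i, rfl⟩) hlamNpos.le hΘ0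
    ((div_le_iff₀ hlamNpos).1 hΘ)
  have key : -(H ⊗ₖ (Sᵀ * P + P * S)
      - (2 * Θ) • ((H * H) ⊗ₖ (P * Matrix.vecMulVec d d * P))) =
      H ⊗ₖ (-(Sᵀ * P + P * S - (2 : ℝ) • (P * Matrix.vecMulVec d d * P)))
      + (2 : ℝ) • ((Θ • (H * H) - H) ⊗ₖ (P * Matrix.vecMulVec d d * P)) := by
    ext ⟨i, j⟩ ⟨k, l⟩
    simp only [Matrix.neg_apply, Matrix.sub_apply, Matrix.add_apply, Matrix.smul_apply,
      Matrix.kronecker_apply, smul_eq_mul]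
    ring
  have hM : (-(H ⊗ₖ (Sᵀ * P + P * S)
      - (2 * Θ) • ((H * H) ⊗ₖ (P * Matrix.vecMulVec d d * P)))).PosDef := by
    rw [key]
    exact (hH.kronecker hLyap).add_posSemidef ((hHH.kronecker hB).smul zero_le_two)
  refine ⟨hM, ?_⟩
  obtain ⟨ε, hε, hle⟩ := hM.exists_pos_mul_norm_sq_le
  refine ⟨ε, hε, fun xb => ?_⟩
  have h := hle xb
  rw [Matrix.neg_mulVec, dotProduct_neg] at h
  linarith
end
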